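/- Let $p \ge 5$ be a prime and $n$ a positive integer. Then $\sum_{k=0}^{n-1}\sum_{j=1}^{p-1} \binom{np}{kp+j}^2 \binom{2kp+2j}{kp+j} \equiv \frac{1}{2} p^2 \left(\frac{p}{3}\right) B_{p-2}\!\left(\frac{1}{3}\right) \sum_{k=0}^{n-1}\binom{n}{k}^2\binom{2k}{k}(n-k)^2 \pmod{p^3}$ (as a congruence of rational numbers, i.e. the $p$-adic valuation of the difference is at least $3$), where $\left(\frac{p}{3}\right)$ denotes the Legendre symbol of $p$ modulo $3$. -/

import Mathlib

open Finset

section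

open Polynomial

theorem natCast_ne_zero_of_lt {p i : ℕ} (h0 : i ≠ 0) (hi : i < p) : (i : ZMod p) ≠ 0 := by
  rw [Ne, ZMod.natCast_eq_zero_iff]
  exact Nat.not_dvd_of_pos_of_lt (Nat.pos_of_ne_zero h0) hi

/-- In characteristic `p`, a polynomial of degree less than `p` is determined by its derivative
and its value at `0`. -/
theorem eq_of_derivative_eq_of_natDegree_lt {p : ℕ} [Fact p.Prime] {f g : (ZMod p)[X]}
    (hf : f.natDegree < p) (hg : g.natDegree < p) (hd : derivative f = derivative g)
    (h0 : f.eval 0 = g.eval 0) : f = g := by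
  ext i
  rcases i with _ | i
  · simpa only [coeff_zero_eq_eval_zero] using h0
  · by_cases hi : i + 1 < p
    · have h := congrArg (fun q => q.coeff i) hd
      simp only [coeff_derivative] at h
      have hne : ((i : ZMod p) + 1) ≠ 0 := by
        exact_mod_cast natCast_ne_zero_of_lt (Nat.succ_ne_zero i) hi
      exact mul_right_cancel₀ hne h
    · rw [coeff_eq_zero_of_natDegree_lt (by omega), coeff_eq_zero_of_natDegree_lt (by omega)]

theorem centralBinom_eq_choose_half {p m : ℕ} [Fact p.Prime] (hm : p = 2 * m + 1) (j : ℕ)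
    (hj : j ≤ m) : (Nat.centralBinom j : ZMod p) = (-4) ^ j * (m.choose j : ZMod p) := by
  induction j with
  | zero => simp
  | succ j ih =>
    have hne : ((j + 1 : ℕ) : ZMod p) ≠ 0 := natCast_ne_zero_of_lt (by omega) (by omega)
    apply mul_left_cancel₀ hne
    have h1 := congrArg (Nat.cast : ℕ → ZMod p) (Nat.succ_mul_centralBinom_succ j)
    have h2 := congrArg (Nat.cast : ℕ → ZMod p) (Nat.choose_succ_right_eq m j)
    have h3 : (2 * m + 1 : ZMod p) = 0 := by
      have : ((2 * m + 1 : ℕ) : ZMod p) = 0 := by rw [← hm]; simp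
      exact_mod_cast this
    rw [Nat.cast_mul, Nat.cast_mul, Nat.cast_sub (by omega : j ≤ m)] at h2
    push_cast at h1 h2 ⊢
    rw [h1, ih (by omega)]
    linear_combination (-(-4) ^ (j + 1)) * h2 + (2 * (-4) ^ j * (m.choose j : ZMod p)) * h3

theorem one_sub_four_mul_pow {p m : ℕ} [Fact p.Prime] (hm : p = 2 * m + 1) {R : Type*} [CommRing R]
    [Algebra (ZMod p) R] (y : R) :
    (1 - 4 * y) ^ m
      = ∑ j ∈ range (m + 1), algebraMap (ZMod p) R (Nat.centralBinom j) * y ^ j := by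
  rw [sub_eq_neg_add, add_pow]
  refine sum_congr rfl fun j hj => ?_
  rw [centralBinom_eq_choose_half hm j (by simpa [Nat.lt_succ_iff] using hj)]
  simp only [map_mul, map_pow, map_neg, map_natCast, map_ofNat, one_pow, neg_mul_eq_neg_mul,
    mul_pow]
  ring

section FinitePolylog

variable (p : ℕ) [Fact p.Prime]

/-- The finite polylogarithm `∑ X ^ i / i ^ s`, `0 < i < p` (for `s > 0`). -/
noncomputable def finitePolylog (s : ℕ) : (ZMod p)[X] :=
  ∑ i ∈ range p, C (((i : ZMod p)⁻¹) ^ s) * X ^ i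

/-- The sum `∑ binom(2j, j) (X (1 - X)) ^ j / j ^ s` over `0 < j ≤ m` (for `s > 0`). -/
noncomputable def centralBinomPolylog (m s : ℕ) : (ZMod p)[X] :=
  ∑ j ∈ range (m + 1), C ((Nat.centralBinom j : ZMod p) * ((j : ZMod p)⁻¹) ^ s)
    * (X * (1 - X)) ^ j

variable {p}

theorem natDegree_finitePolylog_lt (s : ℕ) : (finitePolylog p s).natDegree < p := by
  have hp := (Fact.out : p.Prime).pos
  refine lt_of_le_of_lt (natDegree_sum_le_of_forall_le (n := p - 1) _ _ fun i hi => ?_) (by omega)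
  have := mem_range.1 hi
  exact (natDegree_C_mul_X_pow_le _ _).trans (by omega)

theorem natDegree_comp_one_sub_X_le {R : Type*} [CommRing R] [IsDomain R] (f : R[X]) :
    (f.comp (1 - X)).natDegree ≤ f.natDegree := by
  refine natDegree_comp_le.trans ?_
  have : (1 - X : R[X]).natDegree ≤ 1 := by compute_degree
  nlinarith

theorem natDegree_centralBinomPolylog_lt {m : ℕ} (hm : p = 2 * m + 1) (s : ℕ) :
    (centralBinomPolylog p m s).natDegree < p := by
  refine lt_of_le_of_lt (natDegree_sum_le_of_forall_le (n := 2 * m) _ _ fun j hj => ?_) (by omega)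
  have := mem_range.1 hj
  refine (natDegree_C_mul_le _ _).trans (natDegree_pow_le.trans ?_)
  have : (X * (1 - X) : (ZMod p)[X]).natDegree ≤ 2 := by compute_degree
  nlinarith

theorem eval_zero_finitePolylog (s : ℕ) (hs : s ≠ 0) : (finitePolylog p s).eval 0 = 0 := by
  rw [finitePolylog, eval_finsetSum]
  refine sum_eq_zero fun i _ => ?_
  rcases eq_or_ne i 0 with rfl | hi <;> simp [*]

theorem eval_zero_centralBinomPolylog (m s : ℕ) (hs : s ≠ 0) :
    (centralBinomPolylog p m s).eval 0 = 0 := by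
  rw [centralBinomPolylog, eval_finsetSum]
  refine sum_eq_zero fun i _ => ?_
  rcases eq_or_ne i 0 with rfl | hi <;> simp [*]

theorem X_mul_derivative_finitePolylog_succ (s : ℕ) (hs : s ≠ 0) :
    X * derivative (finitePolylog p (s + 1)) = finitePolylog p s := by
  rw [finitePolylog, finitePolylog, derivative_sum, mul_sum]
  refine sum_congr rfl fun i hi => ?_
  rcases eq_or_ne i 0 with rfl | h0
  · simp [hs]
  have hne : (i : ZMod p) ≠ 0 := natCast_ne_zero_of_lt h0 (mem_range.1 hi)
  obtain ⟨k, rfl⟩ := Nat.exists_eq_succ_of_ne_zero h0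
  rw [derivative_C_mul_X_pow, pow_succ, mul_assoc, inv_mul_cancel₀ hne, mul_one]
  simp only [Nat.succ_eq_add_one, Nat.add_sub_cancel]
  ring

theorem mul_derivative_finitePolylog_one :
    (X * (1 - X)) * derivative (finitePolylog p 1) = X - X ^ p := by
  have h : X * derivative (finitePolylog p 1) = ∑ i ∈ range p, X ^ i - 1 := by
    obtain ⟨q, hq⟩ := Nat.exists_eq_succ_of_ne_zero (Fact.out : p.Prime).ne_zero
    have hr : range p = range (q + 1) := by rw [hq]
    have h1 : ∑ i ∈ range p, (X : (ZMod p)[X]) ^ i - 1 = ∑ i ∈ range q, X ^ (i + 1) := by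
      rw [hr, sum_range_succ']; simp
    have h2 : finitePolylog p 1 = ∑ i ∈ range q, C ((((i + 1 : ℕ) : ZMod p)⁻¹) ^ 1) * X ^ (i + 1) := by
      rw [finitePolylog]
      rw [hr, sum_range_succ']; simp
    rw [h1, h2, derivative_sum, mul_sum]
    refine sum_congr rfl fun i hi => ?_
    have hne : ((i + 1 : ℕ) : ZMod p) ≠ 0 :=
      natCast_ne_zero_of_lt (by omega) (by have := mem_range.1 hi; omega)
    rw [derivative_C_mul_X_pow, pow_one, inv_mul_cancel₀ hne, Nat.add_sub_cancel]
    simp; ring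
  have hg := mul_neg_geom_sum (X : (ZMod p)[X]) p
  linear_combination (1 - X) * h + hg

theorem mul_derivative_centralBinomPolylog_succ {m : ℕ} (hm : p = 2 * m + 1) (s : ℕ) (hs : s ≠ 0) :
    (X * (1 - X)) * derivative (centralBinomPolylog p m (s + 1))
      = (1 - 2 * X) * centralBinomPolylog p m s := by
  rw [centralBinomPolylog, centralBinomPolylog, derivative_sum, mul_sum, mul_sum]
  refine sum_congr rfl fun i hi => ?_
  rcases eq_or_ne i 0 with rfl | h0
  · simp [hs]
  have hne : (i : ZMod p) ≠ 0 :=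
    natCast_ne_zero_of_lt h0 (by have := mem_range.1 hi; omega)
  have hC : (C ((i : ZMod p)⁻¹) * (i : (ZMod p)[X])) = 1 := by
    rw [← C_eq_natCast, ← C_mul, inv_mul_cancel₀ hne, C_1]
  obtain ⟨k, rfl⟩ := Nat.exists_eq_succ_of_ne_zero h0
  rw [derivative_C_mul, derivative_pow_succ]
  simp only [derivative_mul, derivative_X, derivative_sub, derivative_one, C_mul, C_pow,
    Nat.succ_eq_add_one, pow_succ, ← Nat.cast_add_one] at hC ⊢
  rw [C_eq_natCast (k + 1)]
  linear_combination (C (Nat.centralBinom (k+1) : ZMod p) * C (((k + 1 : ℕ) : ZMod p)⁻¹) ^ s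
    * (X * (1 - X)) ^ k * (X * (1 - X)) * (1 - 2 * X)) * hC

theorem mul_derivative_centralBinomPolylog_one {m : ℕ} (hm : p = 2 * m + 1) :
    (X * (1 - X)) * derivative (centralBinomPolylog p m 1)
      = 2 * (X - X ^ p) := by
  have h : (X * (1 - X)) * derivative (centralBinomPolylog p m 1)
      = (1 - 2 * X) * (∑ j ∈ range (m + 1), algebraMap (ZMod p) (ZMod p)[X] (Nat.centralBinom j)
          * (X * (1 - X)) ^ j - 1) := by
    rw [centralBinomPolylog, sum_range_succ', sum_range_succ']
    simp only [derivative_add, derivative_sum]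
    simp only [Nat.centralBinom_zero, Nat.cast_one, Nat.cast_zero, pow_zero, mul_one, map_one,
      derivative_C, add_zero, add_sub_cancel_right, mul_sum]
    refine sum_congr rfl fun i hi => ?_
    have hne : ((i + 1 : ℕ) : ZMod p) ≠ 0 :=
      natCast_ne_zero_of_lt (by omega) (by have := mem_range.1 hi; omega)
    have hC : (C (((i + 1 : ℕ) : ZMod p)⁻¹) * ((i + 1 : ℕ) : (ZMod p)[X])) = 1 := by
      rw [← C_eq_natCast, ← C_mul, inv_mul_cancel₀ hne, C_1]
    rw [derivative_C_mul, derivative_pow_succ]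
    simp only [derivative_mul, derivative_X, derivative_sub, derivative_one, C_mul, pow_succ,
      algebraMap_eq, pow_zero, one_mul, ← Nat.cast_add_one]
    rw [C_eq_natCast (i + 1)]
    linear_combination (C (Nat.centralBinom (i+1) : ZMod p)
      * (X * (1 - X)) ^ i * (X * (1 - X)) * (1 - 2 * X)) * hC
  rw [h, ← one_sub_four_mul_pow hm]
  have h1 : (1 - 2 * X) * (1 - 4 * (X * (1 - X))) ^ m = (1 - 2 * X : (ZMod p)[X]) ^ p := by
    rw [show (1 - 4 * (X * (1 - X)) : (ZMod p)[X]) = (1 - 2 * X) ^ 2 by ring, ← pow_mul]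
    have e (q : (ZMod p)[X]) : q ^ p = q ^ (2 * m + 1) := congrArg (q ^ ·) hm
    rw [e, pow_succ']
  have h2 : (1 - 2 * X : (ZMod p)[X]) ^ p = 1 - 2 * X ^ p := by
    rw [sub_pow_char, one_pow, mul_pow]
    congr 2
    have : (C (2 : ZMod p)) ^ p = C 2 := by rw [← C_pow, ZMod.pow_card]
    exact this
  linear_combination h1 + h2

theorem X_mul_one_sub_X_ne_zero : (X * (1 - X) : (ZMod p)[X]) ≠ 0 := by
  refine mul_ne_zero X_ne_zero fun h => ?_
  have := congrArg (fun q => q.eval 0) h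
  simp at this

theorem centralBinomPolylog_one {m : ℕ} (hm : p = 2 * m + 1) :
    centralBinomPolylog p m 1 = 2 * finitePolylog p 1 := by
  refine eq_of_derivative_eq_of_natDegree_lt (natDegree_centralBinomPolylog_lt hm 1) ?_ ?_ ?_
  · exact (natDegree_C_mul_le (2 : ZMod p) _).trans_lt (natDegree_finitePolylog_lt 1)
  · apply mul_left_cancel₀ X_mul_one_sub_X_ne_zero
    rw [mul_derivative_centralBinomPolylog_one hm, ← mul_derivative_finitePolylog_one]
    simp only [derivative_mul, derivative_ofNat]
    ring
  · rw [eval_zero_centralBinomPolylog _ _ one_ne_zero, eval_mul,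
      eval_zero_finitePolylog _ one_ne_zero, mul_zero]

theorem centralBinomPolylog_comp (m s : ℕ) :
    (centralBinomPolylog p m s).comp (1 - X) = centralBinomPolylog p m s := by
  rw [centralBinomPolylog, Polynomial.sum_comp]
  refine sum_congr rfl fun j _ => ?_
  simp only [mul_comp, C_comp, pow_comp, X_comp, sub_comp, one_comp]
  ring

theorem sum_range_inv_sq (hp3 : 3 < p) : ∑ i ∈ range p, ((i : ZMod p)⁻¹) ^ 2 = 0 := by
  have h1 : ∑ i ∈ range p, ((i : ZMod p)⁻¹) ^ 2 = ∑ x : ZMod p, (x⁻¹) ^ 2 := by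
    refine sum_nbij' (fun i => (i : ZMod p)) (fun x => x.val) ?_ ?_ ?_ ?_ ?_
    · simp
    · intro x _; exact mem_range.2 x.val_lt
    · intro i hi; exact ZMod.val_cast_of_lt (mem_range.1 hi)
    · intro x _; simp
    · simp
  rw [h1, ← FiniteField.sum_pow_lt_card_sub_one (ZMod p) 2 (by rw [ZMod.card]; omega)]
  exact Equiv.sum_comp (Equiv.inv (ZMod p)) (fun x => x ^ 2)

theorem centralBinomPolylog_two {m : ℕ} (hm : p = 2 * m + 1) (hp3 : 3 < p) :
    centralBinomPolylog p m 2 = C 2 * (finitePolylog p 2 + (finitePolylog p 2).comp (1 - X)) := by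
  refine eq_of_derivative_eq_of_natDegree_lt (natDegree_centralBinomPolylog_lt hm 2) ?_ ?_ ?_
  · refine (natDegree_C_mul_le _ _).trans_lt ((natDegree_add_le _ _).trans_lt (max_lt ?_ ?_))
    · exact natDegree_finitePolylog_lt 2
    · exact (natDegree_comp_one_sub_X_le _).trans_lt (natDegree_finitePolylog_lt 2)
  · apply mul_left_cancel₀ X_mul_one_sub_X_ne_zero
    have h1 := X_mul_derivative_finitePolylog_succ (p := p) 1 one_ne_zero
    have h2 := congrArg (fun q : (ZMod p)[X] => q.comp (1 - X)) h1
    have h3 := congrArg (fun q : (ZMod p)[X] => q.comp (1 - X)) (centralBinomPolylog_one hm)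
    simp only [centralBinomPolylog_comp, mul_comp, X_comp, ofNat_comp] at h2 h3
    rw [mul_derivative_centralBinomPolylog_succ hm 1 one_ne_zero]
    simp only [derivative_mul, derivative_C, derivative_add, derivative_comp, derivative_sub,
      derivative_one, derivative_X, zero_mul, zero_add]
    have h4 := centralBinomPolylog_one hm
    have h5 : (C 2 : (ZMod p)[X]) = 2 := rfl
    rw [h5]
    norm_num only at h1 h2 ⊢
    linear_combination (-2 * (1 - X)) * h1 + 2 * X * h2 + (1 - X) * h4 - X * h3
  · rw [eval_zero_centralBinomPolylog _ _ two_ne_zero, eval_mul, eval_add, eval_comp,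
      eval_zero_finitePolylog _ two_ne_zero]
    have : (finitePolylog p 2).eval 1 = 0 := by
      rw [finitePolylog, eval_finsetSum, ← sum_range_inv_sq hp3]
      simp
    simp [this]

end FinitePolylog

theorem pow_add_one_sub_pow_of_mul_eq_one {R : Type*} [CommRing R] {v : R} (hv : v * (1 - v) = 1)
    (i : ℕ) : v ^ i + (1 - v) ^ i = (-1) ^ i * (if 3 ∣ i then 2 else -1) := by
  have hv3 : v ^ 3 = -1 := by linear_combination (-v - 1) * hv
  have hw3 : (1 - v) ^ 3 = -1 := by linear_combination (v - 2) * hv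
  obtain ⟨q, r, hr, rfl⟩ : ∃ q r, r < 3 ∧ i = 3 * q + r :=
    ⟨i / 3, i % 3, Nat.mod_lt _ (by norm_num), by omega⟩
  have h3 : (-1 : R) ^ (3 * q) = (-1) ^ q := by rw [pow_mul]; norm_num
  rw [pow_add, pow_add, pow_add, pow_mul, pow_mul, hv3, hw3, h3]
  interval_cases r
  · rw [if_pos (by omega)]; ring
  · rw [if_neg (by omega)]; ring
  · rw [if_neg (by omega)]; linear_combination (-2 * (-1) ^ q) * hv

theorem sum_range_odd_reflect {M : Type*} [AddCommMonoid M] (g : ℕ → M) (m : ℕ) :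
    ∑ i ∈ range (2 * m + 1), g i
      = g 0 + ∑ j ∈ range m, (g (j + 1) + g (2 * m + 1 - (j + 1))) := by
  rw [sum_range_succ', add_comm, sum_add_distrib, two_mul, sum_range_add,
    ← sum_range_reflect (fun x => g (m + x + 1))]
  congr 2
  refine sum_congr rfl fun j hj => ?_
  have := mem_range.1 hj
  congr 1; omega

theorem sum_range_odd_parity {M : Type*} [AddCommMonoid M] (g : ℕ → M) (m : ℕ) :
    ∑ i ∈ range (2 * m + 1), g i
      = g 0 + ∑ j ∈ range m, (g (2 * (j + 1)) + g (2 * m + 1 - 2 * (j + 1))) := by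
  have h : ∑ i ∈ range (2 * m + 1), g i
      = g 0 + ∑ j ∈ range m, (g (2 * (j + 1)) + g (2 * j + 1)) := by
    induction m with
    | zero => simp
    | succ m ih =>
      rw [show 2 * (m + 1) + 1 = 2 * m + 1 + 1 + 1 by ring, sum_range_succ, sum_range_succ, ih,
        sum_range_succ _ m, add_assoc, add_assoc, add_comm (g (2 * m + 1))]
      rfl
  rw [h, sum_add_distrib, sum_add_distrib, ← sum_range_reflect (fun j => g (2 * j + 1))]
  congr 2
  refine sum_congr rfl fun j hj => ?_
  have := mem_range.1 hj
  congr 1; omega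

theorem natCast_sub_inv_sq {p : ℕ} [Fact p.Prime] {j : ℕ} (hj : j ≤ p) :
    (((p - j : ℕ) : ZMod p)⁻¹) ^ 2 = ((j : ZMod p)⁻¹) ^ 2 := by
  rw [Nat.cast_sub hj, CharP.cast_eq_zero, zero_sub, inv_neg, neg_sq]

theorem sum_alternating_cubic {p : ℕ} [Fact p.Prime] (hp3 : 3 < p) :
    2 * ∑ i ∈ range p, ((i : ZMod p)⁻¹) ^ 2 * ((-1) ^ i * (if 3 ∣ i then 2 else -1))
      = 3 * ∑ i ∈ range p, ((i : ZMod p)⁻¹) ^ 2 * (if 3 ∣ i then 2 else -1) := by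
  have hpr : p.Prime := Fact.out
  obtain ⟨m, hm⟩ : ∃ m, p = 2 * m + 1 := hpr.odd_of_ne_two (by omega)
  have hnd : ¬ 3 ∣ p := fun h => by
    rw [Nat.prime_dvd_prime_iff_eq Nat.prime_three hpr] at h; omega
  have hr : range p = range (2 * m + 1) := by rw [← hm]
  set c : ℕ → ZMod p := fun i => if 3 ∣ i then 2 else -1 with hc
  set s : ℕ → ZMod p := fun i => ((i : ZMod p)⁻¹) ^ 2 with hs
  have hs0 : s 0 = 0 := by simp [hs]
  have h2 : (2 : ZMod p) ≠ 0 := by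
    exact_mod_cast natCast_ne_zero_of_lt (p := p) (i := 2) (by omega) (by omega)
  have hs2 (j : ℕ) : 4 * s (2 * j) = s j := by
    simp only [hs, Nat.cast_mul, Nat.cast_ofNat, mul_inv, mul_pow]
    field_simp
    norm_num
  have hsr {j : ℕ} (hj : j ≤ p) : s (p - j) = s j := natCast_sub_inv_sq hj
  set a := ∑ j ∈ range m, s (j + 1) * c (j + 1)
  set b := ∑ j ∈ range m, s (j + 1) * c (p + (j + 1))
  have hW : ∑ i ∈ range p, s i * c i = -b := by
    rw [hr, sum_range_odd_reflect, hs0, zero_mul, zero_add, ← sum_neg_distrib]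
    refine sum_congr rfl fun j hj => ?_
    have hjm := mem_range.1 hj
    rw [← hm, hsr (by omega)]
    have : c (j + 1) + c (p - (j + 1)) + c (p + (j + 1)) = 0 := by
      have hp12 : p % 3 = 1 ∨ p % 3 = 2 := by omega
      have hj012 : (j + 1) % 3 = 0 ∨ (j + 1) % 3 = 1 ∨ (j + 1) % 3 = 2 := by omega
      simp only [hc]
      split_ifs <;> first | (exfalso; omega) | norm_num
    linear_combination s (j + 1) * this
  have hV : 4 * ∑ i ∈ range p, s i * ((-1) ^ i * c i) = a - b := by
    rw [hr, sum_range_odd_parity, hs0, zero_mul, zero_add, mul_sum, ← sum_sub_distrib]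
    refine sum_congr rfl fun j hj => ?_
    have hjm := mem_range.1 hj
    rw [← hm, hsr (by omega)]
    have e1 : c (2 * (j + 1)) = c (j + 1) := by
      simp only [hc]
      split_ifs <;> first | omega | norm_num
    have e2 : c (p - 2 * (j + 1)) = c (p + (j + 1)) := by
      simp only [hc]
      split_ifs <;> first | omega | norm_num
    have o1 : (-1 : ZMod p) ^ (2 * (j + 1)) = 1 := Even.neg_one_pow (even_two_mul _)
    have o2 : (-1 : ZMod p) ^ (p - 2 * (j + 1)) = -1 :=
      Odd.neg_one_pow ⟨m - (j + 1), by omega⟩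
    rw [e1, e2, o1, o2]
    linear_combination (c (j + 1) - c (p + (j + 1))) * hs2 (j + 1)
  have hW' : 4 * ∑ i ∈ range p, s i * c i = a + b := by
    rw [hr, sum_range_odd_parity, hs0, zero_mul, zero_add, mul_sum, ← sum_add_distrib]
    refine sum_congr rfl fun j hj => ?_
    have hjm := mem_range.1 hj
    rw [← hm, hsr (by omega)]
    have e1 : c (2 * (j + 1)) = c (j + 1) := by
      simp only [hc]
      split_ifs <;> first | omega | norm_num
    have e2 : c (p - 2 * (j + 1)) = c (p + (j + 1)) := by
      simp only [hc]
      split_ifs <;> first | omega | norm_num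
    rw [e1, e2]
    linear_combination (c (j + 1) + c (p + (j + 1))) * hs2 (j + 1)
  apply mul_left_cancel₀ h2
  linear_combination hV - hW' - 2 * hW

theorem sum_cubic_eq_sum_div_three {p : ℕ} [Fact p.Prime] (hp3 : 3 < p) :
    3 * ∑ i ∈ range p, ((i : ZMod p)⁻¹) ^ 2 * (if 3 ∣ i then 2 else -1)
      = ∑ j ∈ range (p / 3 + 1), ((j : ZMod p)⁻¹) ^ 2 := by
  have hpr : p.Prime := Fact.out
  have hnd : ¬ 3 ∣ p := fun h => by
    rw [Nat.prime_dvd_prime_iff_eq Nat.prime_three hpr] at h; omega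
  have h3 : (3 : ZMod p) ≠ 0 := by
    exact_mod_cast natCast_ne_zero_of_lt (p := p) (i := 3) (by omega) (by omega)
  have h1 : ∑ i ∈ range p, ((i : ZMod p)⁻¹) ^ 2 * (if 3 ∣ i then 2 else -1)
      = 3 * ∑ i ∈ range p with 3 ∣ i, ((i : ZMod p)⁻¹) ^ 2 := by
    have h0 := sum_range_inv_sq hp3
    rw [eq_comm, ← sub_eq_zero, ← h0, sum_filter, mul_sum, ← sum_sub_distrib]
    refine sum_congr rfl fun i _ => ?_
    split_ifs <;> ring
  have h2 : ∑ i ∈ range p with 3 ∣ i, ((i : ZMod p)⁻¹) ^ 2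
      = ∑ j ∈ range (p / 3 + 1), (((3 * j : ℕ) : ZMod p)⁻¹) ^ 2 := by
    refine (sum_nbij' (fun j => 3 * j) (fun i => i / 3) ?_ ?_ ?_ ?_ ?_).symm
    · intro j hj; simp only [mem_range, mem_filter] at hj ⊢; omega
    · intro j hj; simp only [mem_range, mem_filter] at hj ⊢; omega
    · intro j hj; simp
    · intro j hj; simp only [mem_filter] at hj; omega
    · intro j hj; rfl
  rw [h1, h2, mul_sum, mul_sum]
  refine sum_congr rfl fun j _ => ?_
  rw [Nat.cast_mul, Nat.cast_ofNat, mul_inv, mul_pow]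
  field_simp

theorem sum_centralBinom_div_sq {p : ℕ} [Fact p.Prime] {m : ℕ} (hm : p = 2 * m + 1) (hp3 : 3 < p) :
    ∑ j ∈ range (m + 1), (Nat.centralBinom j : ZMod p) * ((j : ZMod p)⁻¹) ^ 2
      = ∑ j ∈ range (p / 3 + 1), ((j : ZMod p)⁻¹) ^ 2 := by
  have h2 : (2 : AlgebraicClosure (ZMod p)) ≠ 0 := by
    rw [← map_ofNat (algebraMap (ZMod p) (AlgebraicClosure (ZMod p))) 2, _root_.map_ne_zero]
    exact_mod_cast natCast_ne_zero_of_lt (p := p) (i := 2) (by omega) (by omega)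
  obtain ⟨v, hv⟩ : ∃ v : AlgebraicClosure (ZMod p), v * (1 - v) = 1 := by
    obtain ⟨s, hs⟩ := IsAlgClosed.exists_eq_mul_self (-3 : AlgebraicClosure (ZMod p))
    refine ⟨(1 + s) / 2, ?_⟩
    field_simp
    linear_combination hs
  rw [← sum_cubic_eq_sum_div_three hp3, ← sum_alternating_cubic hp3]
  apply (algebraMap (ZMod p) (AlgebraicClosure (ZMod p))).injective
  have h := congrArg (aeval v) (centralBinomPolylog_two hm hp3)
  simp only [centralBinomPolylog, finitePolylog, map_sum, map_mul, map_add, aeval_C, map_pow,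
    aeval_X, map_sub, map_one, hv, one_pow, mul_one, aeval_comp, ← sum_add_distrib, ← mul_add,
    pow_add_one_sub_pow_of_mul_eq_one hv] at h
  simp only [map_sum, map_mul, map_pow]
  rw [h]
  congr 1
  refine sum_congr rfl fun i _ => ?_
  have h2' : algebraMap (ZMod p) (AlgebraicClosure (ZMod p)) 2 = 2 := map_ofNat _ 2
  split_ifs <;> simp [h2']

theorem padicNorm_natCast_eq_one_of_lt {p i : ℕ} [Fact p.Prime] (h0 : i ≠ 0) (hi : i < p) :
    padicNorm p i = 1 :=
  (padicNorm.nat_eq_one_iff i).2 (Nat.not_dvd_of_pos_of_lt (Nat.pos_of_ne_zero h0) hi)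

theorem padicNorm_bernoulli'_le_one {p : ℕ} [Fact p.Prime] (n : ℕ) (hn : n + 1 < p) :
    padicNorm p (bernoulli' n) ≤ 1 := by
  induction n using Nat.strong_induction_on with
  | _ n ih =>
    rw [bernoulli'_def]
    refine padicNorm.sub.trans (max_le (by simp) (padicNorm.sum_le' (fun k hk => ?_) zero_le_one))
    have hkn := mem_range.1 hk
    have hd : ((n : ℚ) - k + 1) = ((n - k + 1 : ℕ) : ℚ) := by
      rw [Nat.cast_add, Nat.cast_sub hkn.le, Nat.cast_one]
    rw [hd, padicNorm.mul, padicNorm.div,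
      padicNorm_natCast_eq_one_of_lt (i := n - k + 1) (by omega) (by omega), div_one]
    exact mul_le_one₀ (padicNorm.of_nat _) (padicNorm.nonneg _) (ih k hkn (by omega))

theorem padicNorm_bernoulli_le_one {p : ℕ} [Fact p.Prime] (n : ℕ) (hn : n + 1 < p) :
    padicNorm p (_root_.bernoulli n) ≤ 1 := by
  rw [_root_.bernoulli, padicNorm.mul]
  refine mul_le_one₀ ?_ (padicNorm.nonneg _) (padicNorm_bernoulli'_le_one n hn)
  exact_mod_cast padicNorm.of_int (p := p) ((-1) ^ n)

theorem padicNorm_pow {p : ℕ} [Fact p.Prime] (x : ℚ) (i : ℕ) :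
    padicNorm p (x ^ i) = padicNorm p x ^ i := by
  induction i with
  | zero => simp
  | succ i ih => rw [pow_succ, pow_succ, padicNorm.mul, ih]

theorem padicNorm_pow_sub_pow_le {p : ℕ} [Fact p.Prime] {x y : ℚ} (hx : padicNorm p x ≤ 1)
    (hy : padicNorm p y ≤ 1) (i : ℕ) : padicNorm p (x ^ i - y ^ i) ≤ padicNorm p (x - y) := by
  rw [← (Commute.all x y).geom_sum₂_mul, padicNorm.mul]
  refine mul_le_of_le_one_left (padicNorm.nonneg _) (padicNorm.sum_le' (fun k _ => ?_) zero_le_one)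
  rw [padicNorm.mul, padicNorm_pow, padicNorm_pow]
  exact mul_le_one₀ (pow_le_one₀ (padicNorm.nonneg _) hx) (pow_nonneg (padicNorm.nonneg _) _)
    (pow_le_one₀ (padicNorm.nonneg _) hy)

theorem padicNorm_bernoulli_eval_sub_le {p : ℕ} [Fact p.Prime] {x y : ℚ} (hx : padicNorm p x ≤ 1)
    (hy : padicNorm p y ≤ 1) (n : ℕ) (hn : n + 1 < p) :
    padicNorm p ((Polynomial.bernoulli n).eval x - (Polynomial.bernoulli n).eval y)
      ≤ padicNorm p (x - y) := by
  rw [Polynomial.bernoulli_def, eval_finsetSum, eval_finsetSum, ← sum_sub_distrib]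
  refine padicNorm.sum_le' (fun k hk => ?_) (padicNorm.nonneg _)
  rw [eval_monomial, eval_monomial, ← mul_sub, padicNorm.mul, padicNorm.mul]
  refine (mul_le_mul_of_nonneg_left (padicNorm_pow_sub_pow_le hx hy k)
    (mul_nonneg (padicNorm.nonneg _) (padicNorm.nonneg _))).trans
    (mul_le_of_le_one_left (padicNorm.nonneg _) ?_)
  exact mul_le_one₀ (padicNorm_bernoulli_le_one _ (by omega)) (padicNorm.nonneg _)
    (padicNorm.of_nat _)

theorem padicNorm_natCast_mul_le {p : ℕ} [Fact p.Prime] {x : ℚ} (hx : padicNorm p x ≤ 1) :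
    padicNorm p (p * x) ≤ (p : ℚ)⁻¹ := by
  rw [padicNorm.mul, padicNorm.padicNorm_p_of_prime]
  exact mul_le_of_le_one_right (by positivity) hx

theorem padicNorm_bernoulli_eval_one_third_sub_le {p : ℕ} [Fact p.Prime] (hp5 : 5 ≤ p) {N r : ℕ}
    (hN : 3 * N = 1 + p * r) :
    padicNorm p ((Polynomial.bernoulli (p - 2)).eval (1 / 3 : ℚ)
      - ((((p : ℤ) - 2) * ∑ k ∈ range N, (k : ℤ) ^ (p - 3) : ℤ) : ℚ)) ≤ (p : ℚ)⁻¹ := by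
  have hpr : p.Prime := Fact.out
  have h3 : padicNorm p 3 = 1 := by
    exact_mod_cast padicNorm_natCast_eq_one_of_lt (p := p) (i := 3) (by norm_num) (by omega)
  have hsum := Polynomial.sum_range_pow_eq_bernoulli_sub N (p - 3)
  have hs : (p - 3).succ = p - 2 := by omega
  have hodd : Odd (p - 2) := Nat.Odd.sub_even (by omega) (hpr.odd_of_ne_two (by omega)) even_two
  rw [hs, bernoulli_eq_zero_of_odd hodd (by omega), sub_zero, Nat.cast_sub (by omega)] at hsum
  have hb : ((((p : ℤ) - 2) * ∑ k ∈ range N, (k : ℤ) ^ (p - 3) : ℤ) : ℚ)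
      = (Polynomial.bernoulli (p - 2)).eval (N : ℚ) := by
    rw [← hsum]; push_cast; ring
  rw [hb]
  refine (padicNorm_bernoulli_eval_sub_le ?_ (padicNorm.of_nat N) _ (by omega)).trans ?_
  · rw [padicNorm.div, h3]; simp
  · have hN' : (3 * N : ℚ) = 1 + p * r := by exact_mod_cast hN
    have : (1 / 3 : ℚ) - N = p * (-r / 3) := by linear_combination -hN' / 3
    rw [this]
    refine padicNorm_natCast_mul_le ?_
    rw [padicNorm.div, h3, padicNorm.neg, div_one]
    exact padicNorm.of_nat r

theorem pow_sub_three_eq_inv_sq {p : ℕ} [Fact p.Prime] (hp5 : 5 ≤ p) (x : ZMod p) :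
    x ^ (p - 3) = (x⁻¹) ^ 2 := by
  rcases eq_or_ne x 0 with rfl | hx
  · rw [zero_pow (by omega)]; simp
  · have h := ZMod.pow_card_sub_one_eq_one hx
    rw [show p - 1 = (p - 3) + 2 by omega, pow_add] at h
    rw [inv_pow]
    exact eq_inv_of_mul_eq_one_left h

/-- The residue symbol `(p / 3)` turns the sum of `1 / k ^ 2` below the residue of `1 / 3`
modulo `p` into the sum below `p / 3`. -/
theorem exists_sum_inv_sq_eq {p : ℕ} [Fact p.Prime] (hp5 : 5 ≤ p) :
    ∃ N r : ℕ, 3 * N = 1 + p * r ∧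
      ∑ j ∈ range (p / 3 + 1), ((j : ZMod p)⁻¹) ^ 2
        = -(legendreSym 3 p : ZMod p) * ∑ j ∈ range N, ((j : ZMod p)⁻¹) ^ 2 := by
  have hpr : p.Prime := Fact.out
  have hnd : ¬ 3 ∣ p := fun h => by
    rw [Nat.prime_dvd_prime_iff_eq Nat.prime_three hpr] at h; omega
  have hl : legendreSym 3 p = legendreSym 3 ((p % 3 : ℕ) : ℤ) := by
    rw [legendreSym.mod 3 (p : ℤ)]; norm_cast
  obtain ⟨q, hq | hq⟩ : ∃ q, p = 3 * q + 1 ∨ p = 3 * q + 2 := ⟨p / 3, by omega⟩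
  · refine ⟨2 * q + 1, 2, by omega, ?_⟩
    have h1 : legendreSym 3 p = 1 := by
      rw [hl, show p % 3 = 1 by omega]; decide
    have h2 := sum_range_inv_sq (p := p) (by omega)
    have hr : range p = range ((2 * q + 1) + q) := by rw [hq]; congr 1; omega
    rw [hr, sum_range_add] at h2
    rw [h1, show p / 3 = q by omega, sum_range_succ']
    have h3 : ∑ x ∈ range q, (((2 * q + 1 + x : ℕ) : ZMod p)⁻¹) ^ 2
        = ∑ k ∈ range q, (((k + 1 : ℕ) : ZMod p)⁻¹) ^ 2 := by
      rw [← sum_range_reflect]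
      refine sum_congr rfl fun j hj => ?_
      have := mem_range.1 hj
      rw [← natCast_sub_inv_sq (p := p) (j := j + 1) (by omega)]
      congr 4; omega
    rw [h3] at h2
    simp only [Nat.cast_zero, inv_zero, Int.cast_one]
    linear_combination h2
  · refine ⟨q + 1, 1, by omega, ?_⟩
    have h1 : legendreSym 3 p = -1 := by
      rw [hl, show p % 3 = 2 by omega]; decide
    rw [h1, show p / 3 = q by omega]
    simp

theorem choose_prime_sub_one_sq {p : ℕ} [Fact p.Prime] (j : ℕ) (hj : j < p) :
    ((p - 1).choose j : ZMod p) ^ 2 = 1 := by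
  have hpr : p.Prime := Fact.out
  induction j with
  | zero => simp
  | succ j ih =>
    have h : (((p - 1).choose j + (p - 1).choose (j + 1) : ℕ) : ZMod p) = 0 := by
      rw [← Nat.choose_succ_succ', Nat.sub_add_cancel hpr.one_le, ZMod.natCast_eq_zero_iff]
      exact hpr.dvd_choose_self (by omega) hj
    push_cast at h
    rw [← ih (by omega)]
    linear_combination (((p - 1).choose (j + 1) : ZMod p) - (p - 1).choose j) * h

theorem natCast_choose_lucas {p : ℕ} [Fact p.Prime] (n k a b : ℕ) (ha : a < p) (hb : b < p) :
    ((n * p + a).choose (k * p + b) : ZMod p) = a.choose b * n.choose k := by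
  have hp := (Fact.out : p.Prime).pos
  have h := Choose.choose_modEq_choose_mod_mul_choose_div_nat
    (n := n * p + a) (k := k * p + b) (p := p)
  rw [Nat.mul_add_mod_of_lt ha, Nat.mul_add_mod_of_lt hb, mul_comm n, mul_comm k,
    Nat.mul_add_div hp, Nat.mul_add_div hp, Nat.div_eq_of_lt ha, Nat.div_eq_of_lt hb] at h
  simpa [mul_comm] using (ZMod.natCast_eq_natCast_iff _ _ _).2 h

theorem natCast_centralBinom_eq_zero {p : ℕ} [Fact p.Prime] {j : ℕ} (hj : j < p)
    (h : p ≤ 2 * j) : (Nat.centralBinom j : ZMod p) = 0 := by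
  have := natCast_choose_lucas (p := p) 1 0 (2 * j - p) j (by omega) hj
  rw [Nat.choose_eq_zero_of_lt (by omega : 2 * j - p < j),
    show 1 * p + (2 * j - p) = 2 * j by omega, zero_mul, zero_add] at this
  rw [Nat.centralBinom, this, Nat.cast_zero, zero_mul]

theorem natCast_choose_double {p : ℕ} [Fact p.Prime] (k j : ℕ) (hj : j < p) :
    ((2 * k * p + 2 * j).choose (k * p + j) : ZMod p)
      = (2 * k).choose k * Nat.centralBinom j := by
  by_cases h : 2 * j < p
  · rw [natCast_choose_lucas _ _ _ _ h hj, Nat.centralBinom, mul_comm]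
  · have e1 : 2 * k * p + 2 * j = (2 * k + 1) * p + (2 * j - p) := by
      rw [add_mul, one_mul]; omega
    rw [e1, natCast_choose_lucas _ _ _ _ (by omega) hj,
      natCast_centralBinom_eq_zero hj (by omega),
      Nat.choose_eq_zero_of_lt (by omega : 2 * j - p < j)]
    simp

theorem exists_choose_mul_prime {p : ℕ} [Fact p.Prime] {n k j : ℕ} (hk : k < n) (hj0 : j ≠ 0)
    (hj : j < p) : ∃ a : ℕ, (n * p).choose (k * p + j) = p * a ∧
      (a : ZMod p) ^ 2 = (((j : ZMod p))⁻¹) ^ 2 * ((n.choose k : ZMod p) * ((n - k : ℕ) : ZMod p)) ^ 2 := by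
  have hpr : p.Prime := Fact.out
  have hj' := natCast_ne_zero_of_lt hj0 hj
  obtain ⟨N, rfl⟩ := Nat.exists_eq_succ_of_ne_zero (by omega : n ≠ 0)
  obtain ⟨i, rfl⟩ := Nat.exists_eq_succ_of_ne_zero hj0
  have e : (N + 1) * p = (N * p + (p - 1)) + 1 := by
    have := hpr.one_le; rw [add_mul, one_mul]; omega
  have h := Nat.add_one_mul_choose_eq (N * p + (p - 1)) (k * p + i)
  rw [← e, add_assoc (k * p)] at h
  have hd : p ∣ ((N + 1) * p).choose (k * p + (i + 1)) := by
    have h0 := natCast_choose_lucas (p := p) (N + 1) k 0 (i + 1) hpr.pos hj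
    rw [Nat.choose_zero_succ, Nat.cast_zero, zero_mul, add_zero] at h0
    exact (ZMod.natCast_eq_zero_iff _ _).1 h0
  obtain ⟨a, ha⟩ := hd
  refine ⟨a, ha, ?_⟩
  rw [ha, mul_comm (N + 1) p, mul_assoc, mul_assoc] at h
  have h' := congrArg (Nat.cast : ℕ → ZMod p) (Nat.eq_of_mul_eq_mul_left hpr.pos h)
  rw [Nat.cast_mul, natCast_choose_lucas _ _ _ _ (by omega) (by omega)] at h'
  have h2 := congrArg (Nat.cast : ℕ → ZMod p) (Nat.choose_mul_succ_eq N k)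
  have h3 := choose_prime_sub_one_sq (p := p) i (by omega)
  rw [Nat.cast_mul] at h2
  simp only [Nat.succ_eq_add_one, Nat.cast_mul, Nat.cast_add, CharP.cast_eq_zero, mul_zero,
    zero_add] at h' h2 hj' ⊢
  field_simp
  rw [← mul_pow ((N + 1).choose k : ZMod p), ← h2]
  have h4 := congrArg (· ^ 2) h'
  simp only [mul_pow, h3] at h4
  linear_combination -h4

theorem padicNorm_intCast_le_inv {p : ℕ} [Fact p.Prime] {z : ℤ} (hz : (z : ZMod p) = 0) :
    padicNorm p z ≤ (p : ℚ)⁻¹ := by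
  have := (padicNorm.dvd_iff_norm_le (p := p) (n := 1) (z := z)).1
    (by simpa using (ZMod.intCast_zmod_eq_zero_iff_dvd z p).1 hz)
  simpa using this

theorem sum_centralBinom_div_sq_Icc {p : ℕ} [Fact p.Prime] (hp3 : 3 < p) :
    ∑ j ∈ Icc 1 (p - 1), (Nat.centralBinom j : ZMod p) * ((j : ZMod p)⁻¹) ^ 2
      = ∑ j ∈ range (p / 3 + 1), ((j : ZMod p)⁻¹) ^ 2 := by
  obtain ⟨m, hm⟩ : ∃ m, p = 2 * m + 1 := (Fact.out : p.Prime).odd_of_ne_two (by omega)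
  rw [← sum_centralBinom_div_sq hm hp3]
  have h1 : ∑ j ∈ Icc 1 (p - 1), (Nat.centralBinom j : ZMod p) * ((j : ZMod p)⁻¹) ^ 2
      = ∑ j ∈ range p, (Nat.centralBinom j : ZMod p) * ((j : ZMod p)⁻¹) ^ 2 := by
    refine sum_subset (fun j hj => ?_) fun j hj hj' => ?_
    · simp only [mem_Icc, mem_range] at hj ⊢; omega
    · have : j = 0 := by simp only [mem_Icc, mem_range] at hj hj'; omega
      simp [this]
  rw [h1]
  refine (sum_subset (fun j hj => ?_) fun j hj hj' => ?_).symm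
  · simp only [mem_range] at hj ⊢; omega
  · simp only [mem_range] at hj hj'
    rw [natCast_centralBinom_eq_zero hj (by omega), zero_mul]

/-- The double sum is `p ^ 2` times a natural number of known residue modulo `p`. -/
theorem exists_double_sum_eq {p : ℕ} [Fact p.Prime] (hp3 : 3 < p) (n : ℕ) :
    ∃ x : ℕ, ∑ k ∈ range n, ∑ j ∈ Icc 1 (p - 1),
        (n * p).choose (k * p + j) ^ 2 * (2 * k * p + 2 * j).choose (k * p + j) = p ^ 2 * x ∧
      (x : ZMod p) = ((∑ k ∈ range n, n.choose k ^ 2 * (2 * k).choose k * (n - k) ^ 2 : ℕ) : ZMod p)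
        * ∑ j ∈ range (p / 3 + 1), ((j : ZMod p)⁻¹) ^ 2 := by
  have key (k j : ℕ) : ∃ a : ℕ, k < n → j ≠ 0 → j < p →
      (n * p).choose (k * p + j) = p * a ∧ (a : ZMod p) ^ 2
        = (((j : ZMod p))⁻¹) ^ 2 * ((n.choose k : ZMod p) * ((n - k : ℕ) : ZMod p)) ^ 2 := by
    by_cases h : k < n ∧ j ≠ 0 ∧ j < p
    · obtain ⟨a, ha⟩ := exists_choose_mul_prime h.1 h.2.1 h.2.2
      exact ⟨a, fun _ _ _ => ha⟩
    · exact ⟨0, fun h1 h2 h3 => absurd ⟨h1, h2, h3⟩ h⟩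
  choose a ha using key
  refine ⟨∑ k ∈ range n, ∑ j ∈ Icc 1 (p - 1),
    a k j ^ 2 * (2 * k * p + 2 * j).choose (k * p + j), ?_, ?_⟩
  · rw [mul_sum]
    refine sum_congr rfl fun k hk => ?_
    rw [mul_sum]
    refine sum_congr rfl fun j hj => ?_
    have := mem_Icc.1 hj
    rw [(ha k j (mem_range.1 hk) (by omega) (by omega)).1]
    ring
  · rw [← sum_centralBinom_div_sq_Icc hp3, Nat.cast_sum, Nat.cast_sum, sum_mul]
    refine sum_congr rfl fun k hk => ?_
    rw [Nat.cast_sum, mul_sum]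
    refine sum_congr rfl fun j hj => ?_
    have := mem_Icc.1 hj
    rw [Nat.cast_mul, Nat.cast_pow, (ha k j (mem_range.1 hk) (by omega) (by omega)).2,
      natCast_choose_double k j (by omega)]
    push_cast
    ring

end

theorem double_sum_cstar_congr (p : ℕ) (hp : p.Prime) (hp5 : 5 ≤ p) (n : ℕ) (hn : 0 < n) :
    padicNorm p
        ((∑ k ∈ range n, ∑ j ∈ Icc 1 (p - 1),
            ((n * p).choose (k * p + j) : ℚ) ^ 2 * ((2 * k * p + 2 * j).choose (k * p + j))) -
          (1 / 2) * (p : ℚ) ^ 2 * (legendreSym 3 p : ℚ) *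
            (Polynomial.bernoulli (p - 2)).eval (1 / 3 : ℚ) *
              ∑ k ∈ range n, (n.choose k : ℚ) ^ 2 * ((2 * k).choose k) * ((n - k : ℕ) : ℚ) ^ 2) ≤
      (p : ℚ) ^ (-(3 : ℤ)) := by
  have : Fact p.Prime := ⟨hp⟩
  obtain ⟨x, hx, hxp⟩ := exists_double_sum_eq (p := p) (by omega) n
  obtain ⟨N, r, hN, hNp⟩ := exists_sum_inv_sq_eq hp5
  have hB := padicNorm_bernoulli_eval_one_third_sub_le hp5 hN
  set B := (Polynomial.bernoulli (p - 2)).eval (1 / 3 : ℚ)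
  set b : ℤ := ((p : ℤ) - 2) * ∑ k ∈ range N, (k : ℤ) ^ (p - 3) with hb
  set R : ℕ := ∑ k ∈ range n, n.choose k ^ 2 * (2 * k).choose k * (n - k) ^ 2 with hR
  set l : ℤ := legendreSym 3 p
  have hRq : ∑ k ∈ range n, (n.choose k : ℚ) ^ 2 * ((2 * k).choose k) * ((n - k : ℕ) : ℚ) ^ 2
      = R := by rw [hR]; push_cast; rfl
  have hxq : ∑ k ∈ range n, ∑ j ∈ Icc 1 (p - 1),
      ((n * p).choose (k * p + j) : ℚ) ^ 2 * ((2 * k * p + 2 * j).choose (k * p + j))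
      = (p : ℚ) ^ 2 * x := by exact_mod_cast congrArg (Nat.cast : ℕ → ℚ) hx
  have hbp : (b : ZMod p) = -2 * ∑ j ∈ range N, ((j : ZMod p)⁻¹) ^ 2 := by
    rw [hb]
    push_cast
    simp only [pow_sub_three_eq_inv_sq hp5, CharP.cast_eq_zero, zero_sub]
  have hint : padicNorm p ((2 * x - l * b * R : ℤ) : ℚ) ≤ (p : ℚ)⁻¹ := by
    refine padicNorm_intCast_le_inv ?_
    push_cast
    rw [hxp, hNp, hbp]
    ring
  have h2 : padicNorm p 2 = 1 := by
    exact_mod_cast padicNorm_natCast_eq_one_of_lt (p := p) (i := 2) (by norm_num) (by omega)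
  have hdiff : padicNorm p (((2 * x - l * b * R : ℤ) : ℚ) - ((l * R : ℤ) : ℚ) * (B - b))
      ≤ (p : ℚ)⁻¹ := by
    refine padicNorm.sub.trans (max_le hint ?_)
    rw [padicNorm.mul]
    exact (mul_le_of_le_one_left (padicNorm.nonneg _) (padicNorm.of_int _)).trans hB
  have hfac : (p : ℚ) ^ 2 * x - 1 / 2 * (p : ℚ) ^ 2 * l * B * R
      = (p : ℚ) ^ 2 * ((((2 * x - l * b * R : ℤ) : ℚ) - ((l * R : ℤ) : ℚ) * (B - b)) / 2) := by
    push_cast; ring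
  rw [hRq, hxq, hfac, padicNorm.mul, padicNorm_pow, padicNorm.padicNorm_p_of_prime, padicNorm.div,
    h2, div_one]
  calc (p : ℚ)⁻¹ ^ 2 * _ ≤ (p : ℚ)⁻¹ ^ 2 * (p : ℚ)⁻¹ :=
        mul_le_mul_of_nonneg_left hdiff (by positivity)
    _ = (p : ℚ) ^ (-(3 : ℤ)) := by rw [← pow_succ, zpow_neg, inv_pow]; norm_cast
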